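/- Let i ∈ ℕ, let w ∈ {⊥,0,1}^i, let s ∈ ℕ with s ≤ i, and let l ∈ ℤ≥0 with l ≤ i. There exists an (s, l)-balanced fork F ⊢ w if and only if Margin_s(O_l(w)) ≥ 0. -/

import Mathlib

/-- The alphabet `{⊥, 0, 1}`: `none` is `⊥` (empty slot), `some false` is `0`
(special honest slot), `some true` is `1` (adversarial slot). -/
abbrev Trit : Type := Option Bool

/-- Depth of a vertex in a rooted tree given by a parent function, computed with
fuel (fuel `v` suffices since parents have smaller indices). -/
def depthAux (parent : ℕ → ℕ) : ℕ → ℕ → ℕ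
  | 0, _ => 0
  | fuel + 1, v => if v = 0 then 0 else depthAux parent fuel (parent v) + 1

/-- Depth of vertex `v` (number of edges from the root `0`). -/
def treeDepth (parent : ℕ → ℕ) (v : ℕ) : ℕ := depthAux parent v v

/-- A fork `F ⊢ w` with respect to a characteristic string `w ∈ {⊥,0,1}^i`
(positions `1, …, i`).  The vertices are `0, 1, …, m - 1`; vertex `0` is the root,
every other vertex has a parent of smaller index (edges directed away from the
root).  `label` is the labeling `ℓ`: the root has label `0`, every other vertex is
labeled by an index `j ∈ {1, …, i}` with `w[j] ≠ ⊥`; labels strictly increase along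
directed paths; every index `j` with `w[j] = 0` is the label of exactly one vertex;
and the depths of the vertices with such labels increase strictly with the label. -/
structure Fork (i : ℕ) (w : ℕ → Trit) : Type where
  m : ℕ
  m_pos : 0 < m
  parent : ℕ → ℕ
  label : ℕ → ℕ
  parent_root : parent 0 = 0
  parent_lt : ∀ v, 0 < v → v < m → parent v < v
  label_root : label 0 = 0
  label_valid : ∀ v, 0 < v → v < m → 1 ≤ label v ∧ label v ≤ i ∧ w (label v) ≠ none
  label_lt : ∀ v, 0 < v → v < m → label (parent v) < label v
  honest_unique : ∀ j, 1 ≤ j → j ≤ i → w j = some false →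
    ∃! v, 0 < v ∧ v < m ∧ label v = j
  honest_depth_mono : ∀ v₁ v₂, 0 < v₁ → v₁ < m → 0 < v₂ → v₂ < m →
    w (label v₁) = some false → w (label v₂) = some false →
    label v₁ < label v₂ → treeDepth parent v₁ < treeDepth parent v₂

namespace Fork

variable {i : ℕ} {w : ℕ → Trit}

/-- Depth of a vertex of the fork. A tine is a directed path from the root, so
tines are identified with their terminal vertices; the length of the tine ending at
`v` is `F.depth v`. -/
def depth (F : Fork i w) (v : ℕ) : ℕ := treeDepth F.parent v

/-- `u` is an ancestor of `v` (or `u = v`), i.e. `u` lies on the tine ending at `v`. -/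
def Ancestor (F : Fork i w) (u v : ℕ) : Prop := ∃ k : ℕ, F.parent^[k] v = u

/-- The tines ending at `v₁` and `v₂` are `s`-disjoint (`t₁ ≁ₛ t₂`): they share no
vertex whose label is `≥ s`. -/
def SDisjoint (F : Fork i w) (s v₁ v₂ : ℕ) : Prop :=
  ∀ u, F.Ancestor u v₁ → F.Ancestor u v₂ → F.label u < s

/-- `v` is a leaf of the fork. -/
def IsLeaf (F : Fork i w) (v : ℕ) : Prop := ∀ u, 0 < u → u < F.m → F.parent u ≠ v

/-- The fork is closed: every leaf has a label `j` with `w[j] = 0`. -/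
def Closed (F : Fork i w) : Prop :=
  ∀ v, 0 < v → v < F.m → F.IsLeaf v → w (F.label v) = some false

/-- The length of the longest tine of the fork. -/
noncomputable def maxDepth (F : Fork i w) : ℕ :=
  sSup {d : ℕ | ∃ v, v < F.m ∧ d = F.depth v}

/-- `reserve(t)` for the tine `t` ending at `v`: the number of indices `j > ℓ(t)`
with `w[j] = 1`. -/
def reserve (F : Fork i w) (v : ℕ) : ℕ :=
  ((Finset.Icc 1 i).filter fun j => F.label v < j ∧ w j = some true).card

/-- `reach(t) = reserve(t) - gap(t)` for the tine `t` ending at `v`, where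
`gap(t)` is the length of the longest tine minus `length(t)`. -/
noncomputable def reach (F : Fork i w) (v : ℕ) : ℤ :=
  (F.reserve v : ℤ) - ((F.maxDepth : ℤ) - (F.depth v : ℤ))

/-- `Reach(F, w)`: the largest reach attained by any tine of `F`. -/
noncomputable def reachFork (F : Fork i w) : ℤ :=
  sSup {z : ℤ | ∃ v, v < F.m ∧ z = F.reach v}

/-- `Margin_s(F, w)`: the maximum over pairs of `s`-disjoint tines `t₁ ≁ₛ t₂` of
`min{reach(t₁), reach(t₂)}`. -/
noncomputable def marginFork (F : Fork i w) (s : ℕ) : ℤ :=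
  sSup {z : ℤ | ∃ v₁ v₂, v₁ < F.m ∧ v₂ < F.m ∧ F.SDisjoint s v₁ v₂ ∧
    z = min (F.reach v₁) (F.reach v₂)}

/-- The tine ending at `v` is `l`-viable: for every index `j ≤ l` with `w[j] = 0`,
the depth of the (unique) vertex labeled `j` is at most the length of the tine.
A tine is viable iff it is `i`-viable. -/
def Viable (F : Fork i w) (l v : ℕ) : Prop :=
  ∀ j, 1 ≤ j → j ≤ l → w j = some false →
    ∀ u, 0 < u → u < F.m → F.label u = j → F.depth u ≤ F.depth v

/-- The fork is `(s, l)`-balanced: it contains two `l`-viable tines that are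
`s`-disjoint.  It is `s`-balanced iff it is `(s, i)`-balanced. -/
def Balanced (F : Fork i w) (s l : ℕ) : Prop :=
  ∃ v₁ v₂, v₁ < F.m ∧ v₂ < F.m ∧ F.Viable l v₁ ∧ F.Viable l v₂ ∧ F.SDisjoint s v₁ v₂

/-- The length of the longest tine of the closure `F̄` of `F` (the closure is
obtained by trimming all trailing adversarial vertices, so the length of its
longest tine is the maximum depth of an honest vertex or of the root). -/
noncomputable def closureMaxDepth (F : Fork i w) : ℕ :=
  sSup {d : ℕ | ∃ v, v < F.m ∧ (v = 0 ∨ w (F.label v) = some false) ∧ d = F.depth v}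

end Fork

/-- `Reach(w)`: the maximum of `Reach(F, w)` over all closed forks `F ⊢ w`. -/
noncomputable def ReachStr (i : ℕ) (w : ℕ → Trit) : ℤ :=
  sSup {z : ℤ | ∃ F : Fork i w, F.Closed ∧ z = F.reachFork}

/-- `Margin_s(w)`: the maximum of `Margin_s(F, w)` over all closed forks `F ⊢ w`. -/
noncomputable def MarginStr (i : ℕ) (w : ℕ → Trit) (s : ℕ) : ℤ :=
  sSup {z : ℤ | ∃ F : Fork i w, F.Closed ∧ z = F.marginFork s}

/-- `O_l(w)`: the string obtained from `w` by replacing every symbol `0` at a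
position `> l` by `⊥`. -/
def Ol (l : ℕ) (w : ℕ → Trit) : ℕ → Trit :=
  fun j => if l < j ∧ w j = some false then none else w j

namespace Fork

variable {i : ℕ} {w w' : ℕ → Trit}

theorem depthAux_congr {p q : ℕ → ℕ} {v : ℕ} (hp : ∀ u, 0 < u → u ≤ v → p u < u)
    (hpq : ∀ u, u ≤ v → p u = q u) :
    ∀ f g, v ≤ f → v ≤ g → depthAux p f v = depthAux q g v := by
  induction v using Nat.strong_induction_on with
  | _ v ih =>
    intro f g hf hg
    rcases Nat.eq_zero_or_pos v with rfl | hv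
    · cases f <;> cases g <;> simp [depthAux]
    · obtain ⟨f, rfl⟩ : ∃ f', f = f' + 1 := ⟨f - 1, by omega⟩
      obtain ⟨g, rfl⟩ : ∃ g', g = g' + 1 := ⟨g - 1, by omega⟩
      have hlt := hp v hv le_rfl
      simp only [depthAux, hv.ne', if_false, ← hpq v le_rfl]
      rw [ih (p v) hlt (fun u h0 h1 => hp u h0 (by omega))
        (fun u h1 => hpq u (by omega)) f g (by omega) (by omega)]

@[simp] theorem depth_zero (F : Fork i w) : F.depth 0 = 0 := rfl

theorem parent_le (F : Fork i w) {v : ℕ} (hv : v < F.m) : F.parent v ≤ v := by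
  rcases Nat.eq_zero_or_pos v with rfl | h
  · exact F.parent_root.le
  · exact (F.parent_lt v h hv).le

theorem depth_eq (F : Fork i w) {v : ℕ} (h0 : 0 < v) (hv : v < F.m) :
    F.depth v = F.depth (F.parent v) + 1 := by
  have hlt := F.parent_lt v h0 hv
  obtain ⟨n, rfl⟩ : ∃ n, v = n + 1 := ⟨v - 1, by omega⟩
  have h := depthAux_congr (p := F.parent) (q := F.parent) (v := F.parent (n + 1))
    (fun u h0 h1 => F.parent_lt u h0 (by omega)) (fun _ _ => rfl) n (F.parent (n + 1))
    (by omega) le_rfl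
  simp [depth, treeDepth, depthAux, h]

theorem iterate_parent_le (F : Fork i w) {v : ℕ} (hv : v < F.m) (k : ℕ) :
    F.parent^[k] v ≤ v := by
  induction k with
  | zero => simp
  | succ k ih =>
    rw [Function.iterate_succ_apply']
    exact (F.parent_le (by omega)).trans ih

theorem Ancestor.le {F : Fork i w} {u v : ℕ} (h : F.Ancestor u v) (hv : v < F.m) : u ≤ v := by
  obtain ⟨k, rfl⟩ := h
  exact F.iterate_parent_le hv k

theorem Ancestor.trans {F : Fork i w} {a b c : ℕ} (h : F.Ancestor a b) (h' : F.Ancestor b c) :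
    F.Ancestor a c := by
  obtain ⟨k, rfl⟩ := h
  obtain ⟨n, rfl⟩ := h'
  exact ⟨k + n, Function.iterate_add_apply _ _ _ _⟩

theorem ancestor_refl (F : Fork i w) (v : ℕ) : F.Ancestor v v := ⟨0, rfl⟩

theorem ancestor_parent (F : Fork i w) (v : ℕ) : F.Ancestor (F.parent v) v := ⟨1, rfl⟩

theorem label_parent_le (F : Fork i w) {v : ℕ} (hv : v < F.m) :
    F.label (F.parent v) ≤ F.label v := by
  rcases Nat.eq_zero_or_pos v with rfl | h
  · rw [F.parent_root]
  · exact (F.label_lt v h hv).le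

theorem depth_parent_le (F : Fork i w) {v : ℕ} (hv : v < F.m) :
    F.depth (F.parent v) ≤ F.depth v := by
  rcases Nat.eq_zero_or_pos v with rfl | h
  · rw [F.parent_root]
  · rw [F.depth_eq h hv]; omega

theorem Ancestor.label_le_and_depth_le {F : Fork i w} {u v : ℕ} (h : F.Ancestor u v)
    (hv : v < F.m) : F.label u ≤ F.label v ∧ F.depth u ≤ F.depth v := by
  obtain ⟨k, rfl⟩ := h
  induction k with
  | zero => simp
  | succ k ih =>
    rw [Function.iterate_succ_apply']
    have := (F.iterate_parent_le hv k).trans_lt hv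
    exact ⟨(F.label_parent_le this).trans ih.1, (F.depth_parent_le this).trans ih.2⟩

theorem Ancestor.eq_or_parent {F : Fork i w} {u v : ℕ} (h : F.Ancestor u v) :
    u = v ∨ F.Ancestor u (F.parent v) := by
  obtain ⟨k, rfl⟩ := h
  cases k with
  | zero => exact Or.inl rfl
  | succ k => exact Or.inr ⟨k, rfl⟩

theorem label_le (F : Fork i w) {v : ℕ} (hv : v < F.m) : F.label v ≤ i := by
  rcases Nat.eq_zero_or_pos v with rfl | h
  · rw [F.label_root]; omega
  · exact (F.label_valid v h hv).2.1

theorem bddAbove_depth (F : Fork i w) : BddAbove {d : ℕ | ∃ v, v < F.m ∧ d = F.depth v} := by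
  refine ((Set.finite_Iio F.m).image F.depth).bddAbove.mono ?_
  rintro d ⟨v, hv, rfl⟩
  exact ⟨v, hv, rfl⟩

theorem depth_le_maxDepth (F : Fork i w) {v : ℕ} (hv : v < F.m) : F.depth v ≤ F.maxDepth :=
  le_csSup F.bddAbove_depth ⟨v, hv, rfl⟩

theorem exists_depth_eq_maxDepth (F : Fork i w) : ∃ v < F.m, F.depth v = F.maxDepth := by
  obtain ⟨v, hv, h⟩ := Nat.sSup_mem (s := {d : ℕ | ∃ v, v < F.m ∧ d = F.depth v})
    ⟨_, 0, F.m_pos, rfl⟩ F.bddAbove_depth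
  exact ⟨v, hv, h.symm⟩

/-- `G` arises from `F` by adding vertices (possibly for a different string). -/
def Extends (F : Fork i w) (G : Fork i w') : Prop :=
  F.m ≤ G.m ∧ ∀ v, v < F.m → G.parent v = F.parent v ∧ G.label v = F.label v

theorem Extends.refl (F : Fork i w) : F.Extends F := ⟨le_rfl, fun _ _ => ⟨rfl, rfl⟩⟩

theorem Extends.trans {w'' : ℕ → Trit} {F : Fork i w} {G : Fork i w'} {H : Fork i w''}
    (h : F.Extends G) (h' : G.Extends H) : F.Extends H :=
  ⟨h.1.trans h'.1, fun v hv =>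
    ⟨(h'.2 v (hv.trans_le h.1)).1.trans (h.2 v hv).1,
      (h'.2 v (hv.trans_le h.1)).2.trans (h.2 v hv).2⟩⟩

theorem Extends.depth_eq {F : Fork i w} {G : Fork i w'} (h : F.Extends G) {v : ℕ}
    (hv : v < F.m) : G.depth v = F.depth v :=
  (depthAux_congr (fun u h0 h1 => F.parent_lt u h0 (by omega))
    (fun u h1 => (h.2 u (by omega)).1.symm) _ _ le_rfl le_rfl).symm

theorem Extends.ancestor {F : Fork i w} {G : Fork i w'} (h : F.Extends G) {u v : ℕ}
    (hv : v < F.m) (ha : G.Ancestor u v) : F.Ancestor u v := by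
  obtain ⟨k, rfl⟩ := ha
  refine ⟨k, ?_⟩
  induction k with
  | zero => rfl
  | succ k ih =>
    rw [Function.iterate_succ_apply', Function.iterate_succ_apply', ← ih]
    exact ((h.2 _ ((F.iterate_parent_le hv k).trans_lt hv)).1).symm

/-- A vertex whose label is honest for both strings already lies in the smaller fork. -/
theorem Extends.lt_of_honest {F : Fork i w} {G : Fork i w'} (h : F.Extends G) {u : ℕ}
    (h0 : 0 < u) (hu : u < G.m) (hw : w (G.label u) = some false)
    (hw' : w' (G.label u) = some false) : u < F.m := by
  obtain ⟨h1, h2, -⟩ := G.label_valid u h0 hu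
  obtain ⟨x, ⟨hx0, hxm, hx⟩, -⟩ := F.honest_unique _ h1 h2 hw
  obtain ⟨y, -, hy⟩ := G.honest_unique _ h1 h2 hw'
  have e1 := hy u ⟨h0, hu, rfl⟩
  have e2 := hy x ⟨hx0, hxm.trans_le h.1, (h.2 x hxm).2.trans hx⟩
  omega

theorem exists_addLeaf (F : Fork i w) {p a : ℕ} (hp : p < F.m) (hlt : F.label p < a)
    (hai : a ≤ i) (hw : ∀ j, j ≠ a → w' j = w j)
    (ha : (w a = some true ∧ w' a = some true) ∨
      (w a = none ∧ w' a = some false ∧ ∀ v, 0 < v → v < F.m → w (F.label v) = some false →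
        F.label v < a ∧ F.depth v ≤ F.depth p)) :
    ∃ G : Fork i w', F.Extends G ∧ G.m = F.m + 1 ∧ G.parent F.m = p ∧ G.label F.m = a := by
  set par : ℕ → ℕ := fun v => if v = F.m then p else F.parent v with hpar
  set lab : ℕ → ℕ := fun v => if v = F.m then a else F.label v with hlab
  have par_old : ∀ v, v < F.m → par v = F.parent v := fun v hv => by simp [hpar, hv.ne]
  have lab_old : ∀ v, v < F.m → lab v = F.label v := fun v hv => by simp [hlab, hv.ne]
  have par_new : par F.m = p := by simp [hpar]
  have lab_new : lab F.m = a := by simp [hlab]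
  have dep_old : ∀ v, v < F.m → treeDepth par v = F.depth v := fun v hv =>
    (depthAux_congr (fun u h0 h1 => F.parent_lt u h0 (by omega))
      (fun u h1 => (par_old u (by omega)).symm) _ _ le_rfl le_rfl).symm
  have par_lt : ∀ v, 0 < v → v < F.m + 1 → par v < v := by
    intro v h0 hv
    rcases Nat.lt_succ_iff_lt_or_eq.1 hv with h | rfl
    · rw [par_old v h]; exact F.parent_lt v h0 h
    · rw [par_new]; exact hp
  have dep_new : treeDepth par F.m = F.depth p + 1 := by
    have hm := F.m_pos
    rw [← dep_old p hp]
    obtain ⟨n, hn⟩ : ∃ n, F.m = n + 1 := ⟨F.m - 1, by omega⟩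
    have h := depthAux_congr (p := par) (q := par) (v := p)
      (fun u h0 h1 => par_lt u h0 (by omega)) (fun _ _ => rfl) n p (by omega) le_rfl
    have h2 : depthAux par (n + 1) F.m = depthAux par n p + 1 := by
      simp [depthAux, par_new, hm.ne']
    unfold treeDepth
    rw [← h, ← h2, ← hn]
  have old_w : ∀ v, 0 < v → v < F.m → w' (F.label v) = w (F.label v) := by
    intro v h0 hv
    rcases eq_or_ne (F.label v) a with h | h
    · rcases ha with ⟨h1, h2⟩ | ⟨h1, -⟩
      · rw [h, h1, h2]
      · exact absurd (h ▸ h1) (F.label_valid v h0 hv).2.2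
    · exact hw _ h
  refine ⟨
    { m := F.m + 1
      m_pos := Nat.succ_pos _
      parent := par
      label := lab
      parent_root := by rw [par_old 0 F.m_pos, F.parent_root]
      parent_lt := par_lt
      label_root := by rw [lab_old 0 F.m_pos, F.label_root]
      label_valid := ?_
      label_lt := ?_
      honest_unique := ?_
      honest_depth_mono := ?_ },
    ⟨Nat.le_succ _, fun v hv => ⟨par_old v hv, lab_old v hv⟩⟩, rfl, par_new, lab_new⟩
  · intro v h0 hv
    rcases Nat.lt_succ_iff_lt_or_eq.1 hv with h | rfl
    · rw [lab_old v h, old_w v h0 h]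
      exact F.label_valid v h0 h
    · rw [lab_new]
      refine ⟨by omega, hai, ?_⟩
      rcases ha with ⟨-, h⟩ | ⟨-, h, -⟩ <;> simp [h]
  · intro v h0 hv
    rcases Nat.lt_succ_iff_lt_or_eq.1 hv with h | rfl
    · rw [lab_old v h, par_old v h, lab_old _ ((F.parent_lt v h0 h).trans h)]
      exact F.label_lt v h0 h
    · rw [lab_new, par_new, lab_old p hp]; exact hlt
  · intro j h1 hj hwj
    rcases eq_or_ne j a with rfl | hja
    · rcases ha with ⟨-, h⟩ | ⟨hn, -⟩
      · simp [h] at hwj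
      · refine ⟨F.m, ⟨F.m_pos, Nat.lt_succ_self _, lab_new⟩, ?_⟩
        rintro v ⟨h0, hv, hl⟩
        rcases Nat.lt_succ_iff_lt_or_eq.1 hv with h | h
        · rw [lab_old v h] at hl
          exact absurd (hl ▸ hn) (F.label_valid v h0 h).2.2
        · exact h
    · rw [hw j hja] at hwj
      obtain ⟨x, ⟨hx0, hxm, hx⟩, huniq⟩ := F.honest_unique j h1 hj hwj
      refine ⟨x, ⟨hx0, hxm.trans (Nat.lt_succ_self _), (lab_old x hxm).trans hx⟩, ?_⟩
      rintro v ⟨h0, hv, hl⟩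
      rcases Nat.lt_succ_iff_lt_or_eq.1 hv with h | rfl
      · exact huniq v ⟨h0, h, (lab_old v h).symm.trans hl⟩
      · exact absurd (hl.symm.trans lab_new) hja
  · intro v₁ v₂ h₁ hv₁ h₂ hv₂ hw₁ hw₂ hlt'
    rcases Nat.lt_succ_iff_lt_or_eq.1 hv₁ with h | rfl <;>
      rcases Nat.lt_succ_iff_lt_or_eq.1 hv₂ with h' | rfl
    · rw [lab_old _ h, old_w _ h₁ h] at hw₁
      rw [lab_old _ h', old_w _ h₂ h'] at hw₂
      rw [lab_old _ h, lab_old _ h'] at hlt'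
      rw [dep_old _ h, dep_old _ h']
      exact F.honest_depth_mono _ _ h₁ h h₂ h' hw₁ hw₂ hlt'
    · rw [lab_old _ h, old_w _ h₁ h] at hw₁
      rw [lab_new] at hw₂
      rw [dep_old _ h, dep_new]
      rcases ha with ⟨-, hc⟩ | ⟨-, -, hc⟩
      · simp [hc] at hw₂
      · exact Nat.lt_succ_of_le (hc v₁ h₁ h hw₁).2
    · rw [lab_old _ h', old_w _ h₂ h'] at hw₂
      rw [lab_new] at hw₁
      rw [lab_new, lab_old _ h'] at hlt'
      rcases ha with ⟨-, hc⟩ | ⟨-, -, hc⟩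
      · simp [hc] at hw₁
      · exact absurd (hc v₂ h₂ h' hw₂).1 (by omega)
    · omega

/-- A tine can be lengthened to any length its reserve permits by adding adversarial vertices. -/
theorem exists_extends_depth_ge (D n : ℕ) : ∀ (F : Fork i w) (v : ℕ), v < F.m →
    D ≤ F.depth v + n → n ≤ F.reserve v →
    ∃ G : Fork i w, F.Extends G ∧ ∃ x < G.m, D ≤ G.depth x ∧
      ∀ a, G.Ancestor a x → a < F.m → F.Ancestor a v := by
  induction n with
  | zero =>
    intro F v hv hD _
    exact ⟨F, .refl F, v, hv, hD, fun a ha _ => ha⟩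
  | succ n ih =>
    intro F v hv hD hn
    have hne : ((Finset.Icc 1 i).filter fun j => F.label v < j ∧ w j = some true).Nonempty :=
      Finset.card_pos.1 (by unfold reserve at hn; omega)
    set a := Finset.min' _ hne with ha
    have hmem := Finset.min'_mem _ hne
    rw [← ha, Finset.mem_filter, Finset.mem_Icc] at hmem
    obtain ⟨⟨h1, hai⟩, hlt, hwa⟩ := hmem
    obtain ⟨G, hFG, hm, hpar, hlab⟩ := F.exists_addLeaf (w' := w) hv hlt hai (fun _ _ => rfl)
      (Or.inl ⟨hwa, hwa⟩)
    have hdep : G.depth F.m = F.depth v + 1 := by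
      rw [G.depth_eq F.m_pos (by omega), hpar, hFG.depth_eq hv]
    have hres : F.reserve v ≤ G.reserve F.m + 1 := by
      unfold reserve
      rw [hlab]
      refine (Finset.card_le_card (t := insert a ((Finset.Icc 1 i).filter
        fun j => a < j ∧ w j = some true)) ?_).trans (Finset.card_insert_le _ _)
      intro j hj
      have hle : a ≤ j := Finset.min'_le _ _ hj
      rw [Finset.mem_filter] at hj
      rcases hle.eq_or_lt with h | h
      · simp [h]
      · exact Finset.mem_insert_of_mem (Finset.mem_filter.2 ⟨hj.1, h, hj.2.2⟩)
    obtain ⟨H, hGH, x, hx, hDx, hanc⟩ := ih G F.m (by omega) (by omega) (by omega)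
    refine ⟨H, hFG.trans hGH, x, hx, hDx, fun b hb hbm => ?_⟩
    rcases (hanc b hb (by omega)).eq_or_parent with h | h
    · omega
    · rw [hpar] at h
      exact hFG.ancestor hv h

/-- Honest vertices at positions `> k` can be added one after the other on top of a vertex
at least as deep as all other honest ones. -/
theorem exists_extends_of_Ol (n : ℕ) : ∀ (k : ℕ), k + n = i → ∀ (F : Fork i (Ol k w)) (p : ℕ),
    p < F.m → F.label p ≤ k →
    (∀ v, 0 < v → v < F.m → Ol k w (F.label v) = some false → F.depth v ≤ F.depth p) →
    ∃ G : Fork i w, F.Extends G := by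
  induction n with
  | zero =>
    intro k hk F p _ _ _
    have hOl : ∀ j, j ≤ i → Ol k w j = w j := fun j hj => by
      simp [Ol, show ¬ k < j by omega]
    refine ⟨
      { m := F.m
        m_pos := F.m_pos
        parent := F.parent
        label := F.label
        parent_root := F.parent_root
        parent_lt := F.parent_lt
        label_root := F.label_root
        label_valid := fun v h0 hv => by
          rw [← hOl _ (F.label_le hv)]; exact F.label_valid v h0 hv
        label_lt := F.label_lt
        honest_unique := fun j h1 hj hw => F.honest_unique j h1 hj (by rwa [hOl j hj])
        honest_depth_mono := fun v₁ v₂ h₁ hv₁ h₂ hv₂ hw₁ hw₂ =>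
          F.honest_depth_mono v₁ v₂ h₁ hv₁ h₂ hv₂ (by rwa [hOl _ (F.label_le hv₁)])
            (by rwa [hOl _ (F.label_le hv₂)]) },
      le_rfl, fun _ _ => ⟨rfl, rfl⟩⟩
  | succ n ih =>
    intro k hk F p hp hlp hdeep
    by_cases hw : w (k + 1) = some false
    · have hlabel : ∀ v, Ol k w (F.label v) = some false → F.label v ≤ k := by
        intro v h
        by_contra hc
        by_cases h' : w (F.label v) = some false <;> simp_all [Ol]
      obtain ⟨G, hFG, hm, hpar, hlab⟩ := F.exists_addLeaf (w' := Ol (k + 1) w) hp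
        (a := k + 1) (by omega) (by omega)
        (fun j hj => by
          have : k + 1 < j ↔ k < j := by omega
          simp [Ol, this])
        (Or.inr ⟨by simp [Ol, hw], by simp [Ol, hw], fun v h0 hv h =>
          ⟨Nat.lt_succ_of_le (hlabel v h), hdeep v h0 hv h⟩⟩)
      have hmlt : F.m < G.m := by omega
      have hmdep := G.depth_eq F.m_pos hmlt
      rw [hpar] at hmdep
      obtain ⟨H, hGH⟩ := ih (k + 1) (by omega) G F.m hmlt hlab.le (by
        intro v h0 hv h
        have hvm : v ≤ F.m := by omega
        rcases hvm.eq_or_lt with rfl | hvm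
        · exact le_rfl
        · rw [hmdep, hFG.depth_eq hvm, hFG.depth_eq hp]
          rcases eq_or_ne (F.label v) (k + 1) with he | he
          · exact absurd (by simp [he, Ol, hw]) (F.label_valid v h0 hvm).2.2
          · have h2 : k + 1 < F.label v ↔ k < F.label v := by omega
            refine (hdeep v h0 hvm ?_).trans (Nat.le_succ _)
            rw [(hFG.2 v hvm).2] at h
            simpa [Ol, h2] using h)
      exact ⟨H, hFG.trans hGH⟩
    · have he : Ol k w = Ol (k + 1) w := by
        funext j
        rcases eq_or_ne j (k + 1) with rfl | hj
        · simp [Ol, hw]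
        · have : k + 1 < j ↔ k < j := by omega
          simp [Ol, this]
      have ih' := ih (k + 1) (by omega)
      rw [← he] at ih'
      exact ih' F p hp (by omega) hdeep

theorem nonempty_fork (i : ℕ) (w : ℕ → Trit) : Nonempty (Fork i w) := by
  let F : Fork i (Ol 0 w) :=
    { m := 1
      m_pos := one_pos
      parent := id
      label := id
      parent_root := rfl
      parent_lt := fun v _ _ => by omega
      label_root := rfl
      label_valid := fun v _ _ => by omega
      label_lt := fun v _ _ => by omega
      honest_unique := fun j h1 _ h => by
        have : 0 < j := h1
        by_cases hw : w j = some false <;> simp_all [Ol]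
      honest_depth_mono := fun v₁ _ _ _ => by omega }
  obtain ⟨G, -⟩ := exists_extends_of_Ol i 0 (by omega) F 0 one_pos le_rfl
    (fun v h0 hv => absurd hv (by change ¬ v < 1; omega))
  exact ⟨G⟩

/-- The subtree on a set `S` of vertices that contains the root and all ancestors of its
members, with the vertices renumbered by `c`. -/
theorem exists_restrict (F : Fork i w) (S : ℕ → Prop) (hS0 : S 0) (hSm : ∀ v, S v → v < F.m)
    (hSp : ∀ v, S v → S (F.parent v)) (hSw : ∀ v, 0 < v → S v → w' (F.label v) ≠ none)
    (hw : ∀ j, w' j = some false → w j = some false)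
    (hSh : ∀ v, 0 < v → v < F.m → w' (F.label v) = some false → S v) :
    ∃ (G : Fork i w') (c : ℕ → ℕ), c 0 = 0 ∧ (∀ x < G.m, ∃ v, S v ∧ c v = x) ∧
      (∀ u v, S u → S v → c u = c v → u = v) ∧
      ∀ v, S v → c v < G.m ∧ G.parent (c v) = c (F.parent v) ∧ G.label (c v) = F.label v ∧
        G.depth (c v) = F.depth v := by
  classical
  set c : ℕ → ℕ := Nat.count S with hc
  set e : ℕ → ℕ := Nat.nth S with he
  have ec : ∀ v, S v → e (c v) = v := fun v hv => Nat.nth_count hv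
  have c0 : c 0 = 0 := Nat.count_zero S
  have cmono : ∀ u v, S u → u < v → c u < c v := fun u v hu huv => Nat.count_strict_mono hu huv
  have cinj : ∀ u v, S u → S v → c u = c v → u = v := fun u v hu hv h => by
    rw [← ec u hu, h, ec v hv]
  have csurj : ∀ x, x < c F.m → ∃ v, S v ∧ c v = x := by
    intro x hx
    have hlt : ∀ hf : (Set.ofPred S).Finite, x < hf.toFinset.card := fun hf =>
      hx.trans_le (by
        rw [hc]
        simp only [Nat.count_eq_card_filter_range]
        refine Finset.card_le_card fun y hy => ?_
        exact hf.mem_toFinset.2 (Finset.mem_filter.1 hy).2)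
    exact ⟨e x, Nat.nth_mem x hlt, Nat.count_nth hlt⟩
  have cpos : ∀ v, 0 < c v → 0 < v := fun v h => Nat.pos_of_ne_zero fun h0 => by
    rw [h0, c0] at h; omega
  set par : ℕ → ℕ := fun x => c (F.parent (e x)) with hpar
  set lab : ℕ → ℕ := fun x => F.label (e x) with hlab
  have parc : ∀ v, S v → par (c v) = c (F.parent v) := fun v hv => by simp only [hpar, ec v hv]
  have labc : ∀ v, S v → lab (c v) = F.label v := fun v hv => by simp only [hlab, ec v hv]
  have par_lt : ∀ x, 0 < x → x < c F.m → par x < x := by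
    intro x h0 hx
    obtain ⟨v, hv, rfl⟩ := csurj x hx
    rw [parc v hv]
    exact cmono _ _ (hSp v hv) (F.parent_lt v (cpos v h0) (hSm v hv))
  have depc : ∀ v, S v → treeDepth par (c v) = F.depth v := by
    intro v
    induction v using Nat.strong_induction_on with
    | _ v ih =>
      intro hv
      rcases Nat.eq_zero_or_pos v with rfl | h0
      · rw [c0]; rfl
      · have hp := F.parent_lt v h0 (hSm v hv)
        have hcm := cmono v F.m hv (hSm v hv)
        have hcp := cmono _ _ (hSp v hv) hp
        rw [F.depth_eq h0 (hSm v hv), ← ih _ hp (hSp v hv)]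
        obtain ⟨n, hn⟩ : ∃ n, c v = n + 1 := ⟨c v - 1, by omega⟩
        have h := depthAux_congr (p := par) (q := par) (v := c (F.parent v))
          (fun u h0 h1 => par_lt u h0 (by omega)) (fun _ _ => rfl) n _ (by omega) le_rfl
        have h2 : depthAux par (n + 1) (c v) = depthAux par n (c (F.parent v)) + 1 := by
          rw [depthAux, parc v hv, if_neg (by omega)]
        unfold treeDepth
        rw [← h, ← h2, ← hn]
  refine ⟨
    { m := c F.m
      m_pos := c0 ▸ cmono 0 F.m hS0 F.m_pos
      parent := par
      label := lab
      parent_root := by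
        have := parc 0 hS0
        rwa [F.parent_root, c0] at this
      parent_lt := par_lt
      label_root := by
        have := labc 0 hS0
        rwa [F.label_root, c0] at this
      label_valid := ?_
      label_lt := ?_
      honest_unique := ?_
      honest_depth_mono := ?_ },
    c, c0, csurj, cinj, fun v hv => ⟨cmono v F.m hv (hSm v hv), parc v hv, labc v hv, depc v hv⟩⟩
  · intro x h0 hx
    obtain ⟨v, hv, rfl⟩ := csurj x hx
    rw [labc v hv]
    have h := F.label_valid v (cpos v h0) (hSm v hv)
    exact ⟨h.1, h.2.1, hSw v (cpos v h0) hv⟩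
  · intro x h0 hx
    obtain ⟨v, hv, rfl⟩ := csurj x hx
    rw [labc v hv, parc v hv, labc _ (hSp v hv)]
    exact F.label_lt v (cpos v h0) (hSm v hv)
  · intro j h1 hj hwj
    obtain ⟨v, ⟨h0, hvm, hl⟩, huniq⟩ := F.honest_unique j h1 hj (hw j hwj)
    have hv : S v := hSh v h0 hvm (hl ▸ hwj)
    refine ⟨c v, ⟨c0 ▸ cmono 0 v hS0 h0, cmono v F.m hv hvm, (labc v hv).trans hl⟩, ?_⟩
    rintro x ⟨hx0, hx, hxl⟩
    obtain ⟨u, hu, rfl⟩ := csurj x hx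
    rw [huniq u ⟨cpos u hx0, hSm u hu, (labc u hu).symm.trans hxl⟩]
  · intro x y hx0 hx hy0 hy hwx hwy hlt
    obtain ⟨u, hu, rfl⟩ := csurj x hx
    obtain ⟨v, hv, rfl⟩ := csurj y hy
    rw [labc u hu] at hwx hlt
    rw [labc v hv] at hwy hlt
    rw [depc u hu, depc v hv]
    exact F.honest_depth_mono u v (cpos u hx0) (hSm u hu) (cpos v hy0) (hSm v hv)
      (hw _ hwx) (hw _ hwy) hlt

theorem Ol_eq_some_false {l j : ℕ} : Ol l w j = some false ↔ j ≤ l ∧ w j = some false := by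
  unfold Ol
  split_ifs with h
  · simp only [false_iff]; omega
  · constructor
    · intro hw
      exact ⟨by by_contra hc; exact h ⟨by omega, hw⟩, hw⟩
    · exact And.right

theorem Ol_eq_some_true {l j : ℕ} : Ol l w j = some true ↔ w j = some true := by
  unfold Ol
  split_ifs with h
  · simp [h.2]
  · rfl

/-- The vertices of the closure of `F` restricted to positions at most `l`. -/
def Core (F : Fork i w) (l v : ℕ) : Prop :=
  v = 0 ∨ ∃ u, 0 < u ∧ u < F.m ∧ w (F.label u) = some false ∧ F.label u ≤ l ∧ F.Ancestor v u

theorem Core.lt {F : Fork i w} {l v : ℕ} (h : F.Core l v) : v < F.m := by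
  rcases h with rfl | ⟨u, -, hu, -, -, ha⟩
  · exact F.m_pos
  · exact (ha.le hu).trans_lt hu

theorem Core.parent {F : Fork i w} {l v : ℕ} (h : F.Core l v) : F.Core l (F.parent v) := by
  rcases h with rfl | ⟨u, h0, hu, hw, hl, ha⟩
  · exact Or.inl F.parent_root
  · exact Or.inr ⟨u, h0, hu, hw, hl, (F.ancestor_parent v).trans ha⟩

theorem Core.iterate_parent {F : Fork i w} {l v : ℕ} (h : F.Core l v) (k : ℕ) :
    F.Core l (F.parent^[k] v) := by
  induction k with
  | zero => exact h
  | succ k ih => rw [Function.iterate_succ_apply']; exact ih.parent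

theorem exists_core_ancestor (F : Fork i w) (l D : ℕ)
    (hD : ∀ v, 0 < v → v < F.m → w (F.label v) = some false → l < F.label v → D < F.depth v)
    (v : ℕ) (hv : v < F.m) :
    ∃ x, F.Core l x ∧ F.Ancestor x v ∧ min D (F.depth v) ≤ F.depth x +
      ((Finset.Ioc (F.label x) (F.label v)).filter fun j => w j = some true).card := by
  induction v using Nat.strong_induction_on with
  | _ v ih =>
    rcases Nat.eq_zero_or_pos v with rfl | h0
    · exact ⟨0, Or.inl rfl, F.ancestor_refl 0, by simp⟩
    · by_cases hcore : F.Core l v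
      · exact ⟨v, hcore, F.ancestor_refl v, by simp⟩
      · have hp := F.parent_lt v h0 hv
        have hlt := F.label_lt v h0 hv
        obtain ⟨x, hx, ha, hle⟩ := ih _ hp (hp.trans hv)
        refine ⟨x, hx, ha.trans (F.ancestor_parent v), ?_⟩
        have hdep := F.depth_eq h0 hv
        have hxl := (ha.label_le_and_depth_le (hp.trans hv)).1
        have hsub : (Finset.Ioc (F.label x) (F.label (F.parent v))).filter
            (fun j => w j = some true) ⊆
            (Finset.Ioc (F.label x) (F.label v)).filter fun j => w j = some true :=
          Finset.filter_subset_filter _ (Finset.Ioc_subset_Ioc_right hlt.le)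
        obtain hwv | hwv : w (F.label v) = some false ∨ w (F.label v) = some true := by
          have := (F.label_valid v h0 hv).2.2
          rcases h : w (F.label v) with _ | _ | _ <;> simp_all
        · have hl : l < F.label v := by
            by_contra hc
            exact hcore (Or.inr ⟨v, h0, hv, hwv, by omega, F.ancestor_refl v⟩)
          have := hD v h0 hv hwv hl
          have := Finset.card_le_card hsub
          omega
        · have hss := Finset.card_lt_card (Finset.ssubset_iff_subset_ne.2 ⟨hsub, fun he => by
            have hmem : F.label v ∈ (Finset.Ioc (F.label x) (F.label v)).filter
                fun j => w j = some true :=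
              Finset.mem_filter.2 ⟨Finset.mem_Ioc.2 ⟨by omega, le_rfl⟩, hwv⟩
            rw [← he, Finset.mem_filter, Finset.mem_Ioc] at hmem
            omega⟩)
          omega

/-- The closure of the part of `F` lying over positions at most `l`. -/
theorem exists_closed_Ol (F : Fork i w) (l : ℕ) :
    ∃ (G : Fork i (Ol l w)) (c : ℕ → ℕ), G.Closed ∧
      (∀ x < G.m, ∃ v, F.Core l v ∧ c v = x) ∧
      (∀ u v, F.Core l u → F.Core l v → c u = c v → u = v) ∧
      ∀ v, F.Core l v → c v < G.m ∧ G.parent (c v) = c (F.parent v) ∧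
        G.label (c v) = F.label v ∧ G.depth (c v) = F.depth v := by
  obtain ⟨G, c, c0, csurj, cinj, hc⟩ := F.exists_restrict (w' := Ol l w) (F.Core l) (Or.inl rfl)
    (fun v hv => hv.lt) (fun v hv => hv.parent)
    (by
      rintro v h0 (rfl | ⟨u, -, hu, -, hl, ha⟩)
      · omega
      · have h1 := (ha.label_le_and_depth_le hu).1
        have h2 := (F.label_valid v h0 ((ha.le hu).trans_lt hu)).2.2
        simpa [Ol, show ¬ l < F.label v by omega] using h2)
    (fun j h => (Ol_eq_some_false.1 h).2)
    (fun v h0 hv h => Or.inr ⟨v, h0, hv, (Ol_eq_some_false.1 h).2, (Ol_eq_some_false.1 h).1,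
      F.ancestor_refl v⟩)
  refine ⟨G, c, ?_, csurj, cinj, hc⟩
  intro x h0 hx hleaf
  obtain ⟨v, hv, rfl⟩ := csurj x hx
  rcases id hv with rfl | ⟨u, hu0, hu, hw, hl, k, hk⟩
  · omega
  · cases k with
    | zero =>
      obtain rfl : u = v := hk
      rw [(hc u hv).2.2.1, Ol_eq_some_false]
      exact ⟨hl, hw⟩
    | succ k =>
      exfalso
      rw [Function.iterate_succ_apply'] at hk
      set y := F.parent^[k] u with hy
      have hcy : F.Core l y := Or.inr ⟨u, hu0, hu, hw, hl, k, rfl⟩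
      refine hleaf (c y) (Nat.pos_of_ne_zero fun h => ?_) (hc y hcy).1 ?_
      · rw [← c0] at h
        have hy0 := cinj _ _ hcy (Or.inl rfl) h
        rw [hy0, F.parent_root] at hk
        rw [← hk, c0] at h0
        omega
      · rw [(hc y hcy).2.1, hk]

theorem Closed.honest_of_depth_eq_maxDepth {F : Fork i w} (h : F.Closed) {v : ℕ} (h0 : 0 < v)
    (hv : v < F.m) (hd : F.depth v = F.maxDepth) : w (F.label v) = some false := by
  refine h v h0 hv fun u hu0 hu hp => ?_
  have h1 := F.depth_eq hu0 hu
  have h2 := F.depth_le_maxDepth hu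
  rw [hp] at h1
  omega

theorem sSup_nonneg_of_mem {A : Set ℤ} {z : ℤ} (hz : z ∈ A) (h0 : 0 ≤ z) : 0 ≤ sSup A := by
  by_cases hA : BddAbove A
  · exact h0.trans (le_csSup hA hz)
  · rw [csSup_of_not_bddAbove hA]; simp

theorem exists_nonneg_of_sSup_nonneg {A : Set ℤ} (hne : A.Nonempty) (h : 0 ≤ sSup A) :
    ∃ z ∈ A, 0 ≤ z := by
  by_cases hA : BddAbove A
  · exact ⟨_, Int.csSup_mem hne hA, h⟩
  · obtain ⟨z, hz, hlt⟩ := not_bddAbove_iff.1 hA 0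
    exact ⟨z, hz, hlt.le⟩

theorem marginStr_Ol_nonneg {s l : ℕ} (F : Fork i w) (hF : F.Balanced s l) :
    0 ≤ MarginStr i (Ol l w) s := by
  obtain ⟨v₁, v₂, hv₁, hv₂, hvi₁, hvi₂, hdis⟩ := hF
  obtain ⟨G, c, hG, csurj, cinj, hc⟩ := F.exists_closed_Ol l
  obtain ⟨t, ht, htD⟩ := G.exists_depth_eq_maxDepth
  have htop : t = 0 ∨ ∃ u, 0 < u ∧ u < F.m ∧ w (F.label u) = some false ∧ F.label u ≤ l ∧
      F.depth u = G.maxDepth := by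
    rcases Nat.eq_zero_or_pos t with h | h
    · exact Or.inl h
    · have hw := hG.honest_of_depth_eq_maxDepth h ht htD
      obtain ⟨u, hu, rfl⟩ := csurj t ht
      obtain ⟨-, -, hlab, hdep⟩ := hc u hu
      rw [hlab, Ol_eq_some_false] at hw
      refine (Nat.eq_zero_or_pos u).imp (fun hu0 => ?_) fun hu0 =>
        ⟨u, hu0, hu.lt, hw.2, hw.1, hdep ▸ htD⟩
      have := (G.label_valid _ h ht).1
      rw [hlab, hu0, F.label_root] at this
      omega
  have hD : ∀ v, 0 < v → v < F.m → w (F.label v) = some false → l < F.label v →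
      G.maxDepth < F.depth v := by
    intro v h0 hv hw hl
    rcases htop with rfl | ⟨u, hu0, hu, huw, hul, hud⟩
    · rw [← htD, F.depth_eq h0 hv]; simp
    · rw [← hud]
      exact F.honest_depth_mono u v hu0 hu h0 hv huw hw (by omega)
  have hvia : ∀ v, F.Viable l v → G.maxDepth ≤ F.depth v := by
    intro v hvi
    rcases htop with rfl | ⟨u, hu0, hu, huw, hul, hud⟩
    · rw [← htD]; simp
    · rw [← hud]
      exact hvi _ (F.label_valid u hu0 hu).1 hul huw u hu0 hu rfl
  have key : ∀ v, v < F.m → F.Viable l v →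
      ∃ x, F.Core l x ∧ F.Ancestor x v ∧ 0 ≤ G.reach (c x) := by
    intro v hv hvi
    obtain ⟨x, hx, ha, hle⟩ := F.exists_core_ancestor l _ hD v hv
    refine ⟨x, hx, ha, ?_⟩
    rw [min_eq_left (hvia v hvi)] at hle
    have hres : ((Finset.Ioc (F.label x) (F.label v)).filter fun j => w j = some true).card ≤
        G.reserve (c x) := by
      refine Finset.card_le_card fun j hj => ?_
      rw [Finset.mem_filter, Finset.mem_Ioc] at hj
      have := F.label_le hv
      rw [Finset.mem_filter, Finset.mem_Icc, (hc x hx).2.2.1, Ol_eq_some_true]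
      exact ⟨⟨by omega, by omega⟩, hj.1.1, hj.2⟩
    unfold reach
    rw [(hc x hx).2.2.2]
    omega
  obtain ⟨x₁, hx₁, ha₁, hr₁⟩ := key v₁ hv₁ hvi₁
  obtain ⟨x₂, hx₂, ha₂, hr₂⟩ := key v₂ hv₂ hvi₂
  have hiter : ∀ x, F.Core l x → ∀ k, G.parent^[k] (c x) = c (F.parent^[k] x) := by
    intro x hx k
    induction k with
    | zero => rfl
    | succ k ih =>
      rw [Function.iterate_succ_apply', Function.iterate_succ_apply', ih,
        (hc _ (hx.iterate_parent k)).2.1]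
  refine sSup_nonneg_of_mem ⟨G, hG, rfl⟩ (sSup_nonneg_of_mem
    ⟨c x₁, c x₂, (hc x₁ hx₁).1, (hc x₂ hx₂).1, ?_, rfl⟩ (le_min hr₁ hr₂))
  rintro y ⟨k, rfl⟩ ⟨n, hn⟩
  rw [hiter _ hx₁, hiter _ hx₂] at hn
  have heq := cinj _ _ (hx₂.iterate_parent n) (hx₁.iterate_parent k) hn
  rw [hiter _ hx₁, (hc _ (hx₁.iterate_parent k)).2.2.1]
  exact hdis _ (Ancestor.trans ⟨k, rfl⟩ ha₁) (Ancestor.trans ⟨n, heq⟩ ha₂)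

theorem exists_balanced_of_reach_nonneg {s l : ℕ} (hl : l ≤ i) (F : Fork i (Ol l w))
    (hF : F.Closed) {v₁ v₂ : ℕ} (hv₁ : v₁ < F.m) (hv₂ : v₂ < F.m) (hdis : F.SDisjoint s v₁ v₂)
    (hr₁ : 0 ≤ F.reach v₁) (hr₂ : 0 ≤ F.reach v₂) : ∃ H : Fork i w, H.Balanced s l := by
  unfold reach at hr₁ hr₂
  obtain ⟨G₁, hFG₁, x₁, hx₁, hD₁, hanc₁⟩ := F.exists_extends_depth_ge F.maxDepth (F.reserve v₁)
    v₁ hv₁ (by omega) le_rfl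
  have hres : G₁.reserve v₂ = F.reserve v₂ := by unfold reserve; rw [(hFG₁.2 v₂ hv₂).2]
  have hv₂' := hv₂.trans_le hFG₁.1
  obtain ⟨G₂, hG₁₂, x₂, hx₂, hD₂, hanc₂⟩ := G₁.exists_extends_depth_ge F.maxDepth (F.reserve v₂)
    v₂ hv₂' (by rw [hFG₁.depth_eq hv₂]; omega) hres.ge
  have hFG₂ := hFG₁.trans hG₁₂
  obtain ⟨p, hp, hpD⟩ := F.exists_depth_eq_maxDepth
  have hlp : F.label p ≤ l := by
    rcases Nat.eq_zero_or_pos p with rfl | h0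
    · rw [F.label_root]; omega
    · exact (Ol_eq_some_false.1 (hF.honest_of_depth_eq_maxDepth h0 hp hpD)).1
  obtain ⟨H, hH⟩ := exists_extends_of_Ol (i - l) l (by omega) G₂ p (hp.trans_le hFG₂.1)
    (by rw [(hFG₂.2 p hp).2]; exact hlp)
    (fun v h0 hv hw => by
      have hvm := hFG₂.lt_of_honest h0 hv hw hw
      rw [hFG₂.depth_eq hvm, hFG₂.depth_eq hp, hpD]
      exact F.depth_le_maxDepth hvm)
  have hFH := hFG₂.trans hH
  have hGH := hG₁₂.trans hH
  have hviable : ∀ x, F.maxDepth ≤ H.depth x → H.Viable l x := by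
    rintro x hx j h1 hj hw u h0 hu rfl
    have hum := hFH.lt_of_honest h0 hu (Ol_eq_some_false.2 ⟨hj, hw⟩) hw
    rw [hFH.depth_eq hum]
    exact (F.depth_le_maxDepth hum).trans hx
  refine ⟨H, x₁, x₂, hx₁.trans_le hGH.1, hx₂.trans_le hH.1,
    hviable _ (by rwa [hGH.depth_eq hx₁]), hviable _ (by rwa [hH.depth_eq hx₂]), ?_⟩
  intro u hu₁ hu₂
  have h1 := hGH.ancestor hx₁ hu₁
  have h2 := hanc₂ u (hH.ancestor hx₂ hu₂) ((h1.le hx₁).trans_lt hx₁)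
  have hum := (h2.le hv₂').trans_lt hv₂
  rw [(hFH.2 u hum).2]
  exact hdis u (hanc₁ u h1 hum) (hFG₁.ancestor hv₂ h2)

end Fork

/-- There exists an `(s, l)`-balanced fork `F ⊢ w` if and only if
`Margin_s(O_l(w)) ≥ 0`. -/
theorem stmt_14 (i : ℕ) (w : ℕ → Trit) (s : ℕ) (hs1 : 1 ≤ s) (hsi : s ≤ i)
    (l : ℕ) (hl : l ≤ i) :
    (∃ F : Fork i w, F.Balanced s l) ↔ 0 ≤ MarginStr i (Ol l w) s := by
  constructor
  · rintro ⟨F, hF⟩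
    exact F.marginStr_Ol_nonneg hF
  · intro h
    obtain ⟨F⟩ := Fork.nonempty_fork i w
    obtain ⟨G, -, hG, -⟩ := F.exists_closed_Ol l
    obtain ⟨_, ⟨G, hG, rfl⟩, hz⟩ := Fork.exists_nonneg_of_sSup_nonneg
      (A := {z : ℤ | ∃ F : Fork i (Ol l w), F.Closed ∧ z = F.marginFork s}) ⟨_, G, hG, rfl⟩ h
    have hroot : G.SDisjoint s 0 0 := fun u hu _ => by
      have := hu.le G.m_pos
      obtain rfl : u = 0 := by omega
      rw [G.label_root]
      omega
    obtain ⟨_, ⟨v₁, v₂, hv₁, hv₂, hdis, rfl⟩, hz⟩ := Fork.exists_nonneg_of_sSup_nonneg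
      (A := {z : ℤ | ∃ v₁ v₂, v₁ < G.m ∧ v₂ < G.m ∧ G.SDisjoint s v₁ v₂ ∧
        z = min (G.reach v₁) (G.reach v₂)}) ⟨_, 0, 0, G.m_pos, G.m_pos, hroot, rfl⟩ hz
    obtain ⟨hr₁, hr₂⟩ := le_min_iff.1 hz
    exact G.exists_balanced_of_reach_nonneg hl hG hv₁ hv₂ hdis hr₁ hr₂
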